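/- Suppose (A,B,C) ≠ (6,7,10) is a triple of positive integers with A!·B! = C! and A ≤ B ≤ C - 2, and suppose B ≥ 10^6. Then A ≤ log(B+1)/log 2 + 2·log log(B+1)/log 2 + 2.1221. -/

import Mathlib

lemma two_pow_digits_sum_le (n : ℕ) : 2 ^ (Nat.digits 2 n).sum ≤ n + 1 := by
  induction n using Nat.strong_induction_on with
  | _ n ih =>
    rcases Nat.eq_zero_or_pos n with rfl | hn
    · simp
    · rw [Nat.digits_def' one_lt_two hn, List.sum_cons, pow_add]
      have h := ih (n / 2) (by omega)
      rcases Nat.mod_two_eq_zero_or_one n with h2 | h2 <;> rw [h2] <;> omega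

lemma digits_sum_mul_log_two_le (n : ℕ) :
    ((Nat.digits 2 n).sum : ℝ) * Real.log 2 ≤ Real.log (n + 1) := by
  rw [← Real.log_pow]
  exact Real.log_le_log (by positivity) (by exact_mod_cast two_pow_digits_sum_le n)

lemma log_factorial_le_mul_log_sub (n : ℕ) :
    Real.log (n.factorial : ℝ) ≤ (n + 1) * Real.log (n + 1) - n := by
  induction n with
  | zero => simp
  | succ n ih =>
    have h1 : (0 : ℝ) < n + 1 := by positivity
    have h2 : (0 : ℝ) < n + 1 + 1 := by positivity
    rw [Nat.factorial_succ]
    push_cast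
    rw [Real.log_mul h1.ne' (by positivity)]
    have h3 := Real.one_sub_inv_le_log_of_pos (div_pos h2 h1)
    rw [Real.log_div h2.ne' h1.ne', inv_div] at h3
    have h4 := mul_le_mul_of_nonneg_left h3 h2.le
    have h5 : ((n : ℝ) + 1 + 1) * (1 - (n + 1) / (n + 1 + 1)) = 1 := by
      field_simp; ring
    linarith

/-- Legendre's formula at the prime 2, applied to both sides of `A! * B! = (B + k)!`. -/
lemma digits_sum_of_factorial_mul_eq {A B k : ℕ} (hk : 0 < B + k)
    (h : A.factorial * B.factorial = (B + k).factorial) :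
    A + 1 ≤ k + (Nat.digits 2 A).sum + (Nat.digits 2 B).sum := by
  have hv := congrArg (padicValNat 2) h
  rw [padicValNat.mul (Nat.factorial_ne_zero _) (Nat.factorial_ne_zero _)] at hv
  have legendre (n : ℕ) := sub_one_mul_padicValNat_factorial (p := 2) n
  have hA := legendre A
  have hB := legendre B
  have hC := legendre (B + k)
  have hA' := Nat.digit_sum_le 2 A
  have hB' := Nat.digit_sum_le 2 B
  have hC' := Nat.digit_sum_le 2 (B + k)
  have hpos : 0 < (Nat.digits 2 (B + k)).sum := by
    have hlast := Nat.getLast_digit_ne_zero 2 hk.ne'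
    have hle := List.le_sum_of_mem
      (List.getLast_mem (Nat.digits_ne_nil_iff_ne_zero (b := 2).mpr hk.ne'))
    omega
  omega

lemma log_le_of_sum {x y : ℝ} (n : ℕ) (hx : 0 ≤ x) (hy : 0 < y)
    (h : y ≤ ∑ i ∈ Finset.range n, x ^ i / i.factorial) : Real.log y ≤ x :=
  (Real.log_le_iff_le_exp hy).mpr (h.trans (Real.sum_le_exp_of_nonneg hx n))

lemma log_million_gt : 13.81 < Real.log (10 ^ 6) := by
  have h : (10 : ℝ) ^ 6 = 2 ^ 20 * (10 ^ 6 / 2 ^ 20) := by norm_num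
  rw [h, Real.log_mul (by norm_num) (by norm_num), Real.log_pow]
  have := Real.one_sub_inv_le_log_of_pos (show (0 : ℝ) < 10 ^ 6 / 2 ^ 20 by norm_num)
  have := Real.log_two_gt_d9
  norm_num at *
  linarith

lemma log_thirteen_le : Real.log 13.81 ≤ 2.626 :=
  log_le_of_sum 13 (by norm_num) (by norm_num) (by norm_num [Finset.sum_range_succ, Nat.factorial])

lemma log_quadratic_le {L : ℝ} (hL : 13.81 ≤ L) :
    2 * Real.log L ^ 2 + 2.1645 * Real.log L ≤ 1.42 * L ∧
      2 * Real.log L + 2.1645 ≤ 0.54 * L := by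
  have hpos : 0 < L := by linarith
  have ha := log_thirteen_le
  have ha0 : 0 ≤ Real.log 13.81 := Real.log_nonneg (by norm_num)
  obtain ⟨δ, hδ⟩ : ∃ δ, δ = Real.log L - Real.log 13.81 := ⟨_, rfl⟩
  have hδ0 : 0 ≤ δ := by
    rw [hδ, sub_nonneg]; exact Real.log_le_log (by norm_num) hL
  have hexp : L = 13.81 * Real.exp δ := by
    rw [hδ, Real.exp_sub, Real.exp_log hpos, Real.exp_log (by norm_num)]; field_simp
  have hq := Real.quadratic_le_exp_of_nonneg hδ0
  have hl : Real.log L ≤ 2.626 + δ := by linarith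
  have hl0 : 0 ≤ Real.log L := Real.log_nonneg (by linarith)
  have hsq : Real.log L ^ 2 ≤ (2.626 + δ) ^ 2 := by gcongr
  constructor <;> nlinarith [sq_nonneg δ]

lemma log_gap_at_threshold {L y : ℝ} (hL : 13.81 ≤ L)
    (hy : y = (L + 2 * Real.log L) / Real.log 2 + 3.1221) :
    L / Real.log 2 * (L + Real.log y) + 1 < y * (L - Real.log y + 1) := by
  have hpos : 0 < L := by linarith
  have hc1 := Real.log_two_gt_d9
  have hc2 := Real.log_two_lt_d9
  have hc0 : 0 < Real.log 2 := by linarith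
  obtain ⟨h1, h2⟩ := log_quadratic_le hL
  have hl0 : 0 ≤ Real.log L := Real.log_nonneg (by linarith)
  have hlc : -Real.log (Real.log 2) ≤ 0.3667 := by
    rw [← Real.log_inv]
    refine (Real.log_le_log (by positivity) (inv_anti₀ (by norm_num)
      (show (0.6931 : ℝ) ≤ Real.log 2 by linarith))).trans ?_
    exact log_le_of_sum 9 (by norm_num) (by norm_num)
      (by norm_num [Finset.sum_range_succ, Nat.factorial])
  obtain ⟨u, hu⟩ : ∃ u, u = (2 * Real.log L + 3.1221 * Real.log 2) / L := ⟨_, rfl⟩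
  have huL : u * L = 2 * Real.log L + 3.1221 * Real.log 2 := by rw [hu]; field_simp
  have hu0 : 0 ≤ u := by rw [hu]; positivity
  have hu1 : u ≤ 0.54 := by
    rw [hu, div_le_iff₀ hpos]; linarith
  have hul : u * Real.log L ≤ 1.42 := by
    rw [hu, div_mul_eq_mul_div, div_le_iff₀ hpos]; nlinarith
  have hw : Real.log (1 + u) ≤ 0.432 :=
    (Real.log_le_log (by positivity) (by linarith)).trans
      (log_le_of_sum (y := 1.54) 9 (by norm_num) (by norm_num)
        (by norm_num [Finset.sum_range_succ, Nat.factorial]))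
  have hyu : y = L / Real.log 2 * (1 + u) := by
    rw [hy, hu]; field_simp; ring
  have ht : Real.log y = Real.log L - Real.log (Real.log 2) + Real.log (1 + u) := by
    rw [hyu, Real.log_mul (by positivity) (by positivity),
      Real.log_div hpos.ne' hc0.ne']
  have ht' : Real.log y ≤ Real.log L + 0.7987 := by linarith
  have hut : (2 + u) * Real.log y ≤ (2 + u) * (Real.log L + 0.7987) := by gcongr
  have hcL : Real.log 2 / L ≤ 0.06 := by rw [div_le_iff₀ hpos]; linarith
  have hbr : Real.log 2 / L < 1 + u + u * L - (2 + u) * Real.log y := by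
    nlinarith
  have hr : 0 < L / Real.log 2 := by positivity
  have hmul := mul_lt_mul_of_pos_left hbr hr
  have hone : L / Real.log 2 * (Real.log 2 / L) = 1 := by field_simp
  rw [hone] at hmul
  have heq : y * (L - Real.log y + 1) - L / Real.log 2 * (L + Real.log y) =
      L / Real.log 2 * (1 + u + u * L - (2 + u) * Real.log y) := by
    generalize Real.log y = t
    rw [hyu]; ring
  linarith

lemma two_mul_sq_div_log_two_add_one_lt_exp {L : ℝ} (hL : 13.81 ≤ L) :
    2 * L ^ 2 / Real.log 2 + 1 < Real.exp (L - 1) := by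
  have hc := Real.log_two_gt_d9
  have h4 := Real.pow_div_factorial_le_exp (L - 1) (by linarith) 4
  refine lt_of_lt_of_le ?_ h4
  have h1 : 2 * L ^ 2 / Real.log 2 ≤ 3 * L ^ 2 := by
    rw [div_le_iff₀ (by linarith)]
    nlinarith [sq_nonneg L]
  have h2 : 160 * (L - 1) ^ 2 ≤ (L - 1) ^ 4 := by
    have : 160 ≤ (L - 1) ^ 2 := by nlinarith
    nlinarith [sq_nonneg (L - 1)]
  norm_num [Nat.factorial]
  nlinarith

lemma log_gap_of_threshold_le {L y : ℝ} (hL : 13.81 ≤ L)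
    (hy : (L + 2 * Real.log L) / Real.log 2 + 3.1221 ≤ y) (hyL : Real.log y ≤ L) :
    L / Real.log 2 * (L + Real.log y) + 1 < y * (L - Real.log y + 1) := by
  have hpos : 0 < L := by linarith
  have hc0 : 0 < Real.log 2 := Real.log_pos one_lt_two
  have hl0 : 0 ≤ Real.log L := Real.log_nonneg (by linarith)
  obtain ⟨z, hz⟩ : ∃ z, z = (L + 2 * Real.log L) / Real.log 2 + 3.1221 := ⟨_, rfl⟩
  rw [← hz] at hy
  have hgap := log_gap_at_threshold hL hz
  have hzL : L / Real.log 2 ≤ z := by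
    rw [hz, add_div]
    have : 0 ≤ 2 * Real.log L / Real.log 2 := by positivity
    linarith
  have hz0 : 0 < z := lt_of_lt_of_le (by positivity) hzL
  have hy0 : 0 < y := by linarith
  rcases le_or_gt (Real.log y) (L - 1) with ht | ht
  · obtain ⟨s, hs⟩ : ∃ s, s = Real.log y - Real.log z := ⟨_, rfl⟩
    have hs0 : 0 ≤ s := by rw [hs, sub_nonneg]; exact Real.log_le_log hz0 hy
    have hys : z * (1 + s) ≤ y := by
      have hexp : y = z * Real.exp s := by
        rw [hs, Real.exp_sub, Real.exp_log hz0, Real.exp_log hy0]; field_simp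
      rw [hexp]
      have := Real.add_one_le_exp s
      gcongr
      linarith
    have h1 : z * (1 + s) * (L - Real.log y + 1) ≤ y * (L - Real.log y + 1) :=
      mul_le_mul_of_nonneg_right hys (by linarith)
    have h2 : L / Real.log 2 * s ≤ z * (L - Real.log y) * s := by
      refine mul_le_mul_of_nonneg_right (hzL.trans ?_) hs0
      exact le_mul_of_one_le_right hz0.le (by linarith)
    have ht' : Real.log y = Real.log z + s := by linarith
    rw [ht'] at h1 h2 ⊢
    nlinarith
  · have hexp : Real.exp (L - 1) < y := (Real.lt_log_iff_exp_lt hy0).mp ht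
    have hbig := two_mul_sq_div_log_two_add_one_lt_exp hL
    have h1 : L / Real.log 2 * (L + Real.log y) ≤ 2 * L ^ 2 / Real.log 2 := by
      calc L / Real.log 2 * (L + Real.log y) ≤ L / Real.log 2 * (L + L) := by gcongr
        _ = _ := by ring
    have h2 : y ≤ y * (L - Real.log y + 1) :=
      le_mul_of_one_le_right hy0.le (by linarith)
    linarith


theorem bound_A (A B C : ℕ) (hA : 0 < A) (hAB : A ≤ B) (hBC : B ≤ C - 2) (hC : 2 ≤ C)
    (h : Nat.factorial A * Nat.factorial B = Nat.factorial C)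
    (hne : (A, B, C) ≠ (6, 7, 10)) (hB : 10 ^ 6 ≤ B) :
    (A : ℝ) ≤ Real.log (B + 1) / Real.log 2
      + 2 * Real.log (Real.log (B + 1)) / Real.log 2 + 2.1221 := by
  obtain ⟨k, rfl⟩ : ∃ k, C = B + k := ⟨C - B, by omega⟩
  have hdig := digits_sum_of_factorial_mul_eq (by omega) h
  have hfac : (B + 1) ^ k ≤ A.factorial := by
    have := Nat.factorial_mul_pow_le_factorial (m := B) (n := k)
    rw [← h, mul_comm] at this
    exact Nat.le_of_mul_le_mul_right this (Nat.factorial_pos B)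
  have hlogfac : k * Real.log (B + 1) ≤ Real.log (A.factorial : ℝ) := by
    rw [← Real.log_pow]
    exact Real.log_le_log (by positivity) (by exact_mod_cast hfac)
  have hup := hlogfac.trans (log_factorial_le_mul_log_sub A)
  have hsA := digits_sum_mul_log_two_le A
  have hsB := digits_sum_mul_log_two_le B
  have hL : 13.81 ≤ Real.log (B + 1) := by
    refine log_million_gt.le.trans (Real.log_le_log (by norm_num) ?_)
    have : (10 : ℝ) ^ 6 ≤ B := by exact_mod_cast hB
    linarith
  have hAL : Real.log ((A : ℝ) + 1) ≤ Real.log (B + 1) :=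
    Real.log_le_log (by positivity) (by gcongr)
  have hc0 : 0 < Real.log 2 := Real.log_pos one_lt_two
  by_contra! hcon
  have hgap := log_gap_of_threshold_le hL (y := A + 1) (by rw [add_div]; linarith) hAL
  have hdig' : (A : ℝ) + 1 ≤ k + (Nat.digits 2 A).sum + (Nat.digits 2 B).sum := by
    exact_mod_cast hdig
  rw [← le_div_iff₀ hc0] at hsA hsB
  have hk : (A : ℝ) + 1 ≤
      k + Real.log (A + 1) / Real.log 2 + Real.log (B + 1) / Real.log 2 := by linarith
  have hmul := mul_le_mul_of_nonneg_right hk (show 0 ≤ Real.log ((B : ℝ) + 1) by linarith)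
  have heq : Real.log ((B : ℝ) + 1) / Real.log 2 * (Real.log (B + 1) + Real.log (A + 1)) =
      (Real.log (A + 1) / Real.log 2 + Real.log (B + 1) / Real.log 2) * Real.log (B + 1) := by
    ring
  linarith
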